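/- For all real numbers β, δ, the series defining F_{β,δ} converges locally uniformly on ℂ \ P_{β,δ}, the function F_{β,δ} is analytic (complex differentiable) on ℂ \ P_{β,δ}, and F_{β,δ}(z) = ζ_{β,δ}(z) for every z with Re z > −β + |δ|; thus F_{β,δ} is an analytic continuation of ζ_{β,δ} to ℂ \ P_{β,δ}. -/

import Mathlib

open Complex Real Filter Finset Topology

/-- The q-number `[x]_q = (q^x - q^{-x})/(q - q⁻¹)`. -/
noncomputable def qnum (q x : ℝ) : ℝ := (q ^ x - q ^ (-x)) / (q - q⁻¹)

/-- For a positive real `a` and `w : ℂ`, `a^w := exp(w · ln a)`. -/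
noncomputable def rcpow (a : ℝ) (w : ℂ) : ℂ := Complex.exp (w * (Real.log a : ℂ))

/-- The `(n,j)`-term of the q-zeta double series, corresponding to
`l = n + 1/2` and `k = j - n - 1/2`: `q^{βl+δk} · [l+1/2]_q^{-z}`. -/
noncomputable def qzetaTerm (q β δ : ℝ) (z : ℂ) (n j : ℕ) : ℂ :=
  ((q ^ (β * ((n : ℝ) + 1/2) + δ * ((j : ℝ) - (n : ℝ) - 1/2)) : ℝ) : ℂ) *
    rcpow (qnum q ((n : ℝ) + 1)) (-z)

/-- The q-zeta function `ζ_{β,δ}(z)` as a double series. -/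
noncomputable def qzeta (q β δ : ℝ) (z : ℂ) : ℂ :=
  ∑' n : ℕ, ∑ j ∈ Finset.range (2 * n + 2), qzetaTerm q β δ z n j

/-- The generalized binomial coefficient `C(z+j-1, j) = (1/j!)·∏_{i=0}^{j-1}(z+i)`. -/
noncomputable def binomC (z : ℂ) (j : ℕ) : ℂ :=
  (∏ i ∈ Finset.range j, (z + (i : ℂ))) / (Nat.factorial j : ℂ)

/-- The `j`-th term of the series defining `F_{β,δ}(z)`. -/
noncomputable def Fterm (q β δ : ℝ) (z : ℂ) (j : ℕ) : ℂ :=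
  binomC z j * (q : ℂ) ^ (2 * j) /
    ((1 - rcpow q (((β - δ + 2 * (j : ℝ)) : ℝ) + z)) *
     (1 - rcpow q (((β + δ + 2 * (j : ℝ)) : ℝ) + z)))

/-- The meromorphic continuation `F_{β,δ}`. -/
noncomputable def Ffun (q β δ : ℝ) (z : ℂ) : ℂ :=
  ((q ^ (β / 2) * (q ^ (-δ / 2) + q ^ (δ / 2)) : ℝ) : ℂ) * rcpow (1 - q ^ 2) z *
    ∑' j : ℕ, Fterm q β δ z j

/-- The set `P_{β,δ}` where some denominator `1 - q^{β±δ+2m+z}` vanishes. -/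
def poleSet (q β δ : ℝ) : Set ℂ :=
  {z : ℂ | ∃ (m : ℕ) (k : ℤ),
    z = ((-β + δ - 2 * (m : ℝ) : ℝ) : ℂ) +
        2 * (Real.pi : ℂ) * Complex.I * (k : ℂ) / (Real.log q : ℂ) ∨
    z = ((-β - δ - 2 * (m : ℝ) : ℝ) : ℂ) +
        2 * (Real.pi : ℂ) * Complex.I * (k : ℂ) / (Real.log q : ℂ)}

theorem binomC_eq_choose (z : ℂ) (j : ℕ) : binomC z j = Ring.choose (z + j - 1) j := by
  have hprod : (ascPochhammer ℂ j).eval z = ∏ i ∈ Finset.range j, (z + (i : ℂ)) := by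
    induction j with
    | zero => simp
    | succ k ih => rw [ascPochhammer_succ_eval, ih, Finset.prod_range_succ]
  have h := Ring.factorial_nsmul_multichoose_eq_ascPochhammer z j
  rw [Polynomial.ascPochhammer_smeval_eq_eval, hprod, nsmul_eq_mul] at h
  rw [← Ring.multichoose_eq, binomC, ← h,
    mul_div_cancel_left₀ _ (Nat.cast_ne_zero.mpr j.factorial_ne_zero)]

theorem norm_binomC_le {z : ℂ} {m : ℕ} (hz : ‖z‖ ≤ m + 1) (j : ℕ) :
    ‖binomC z j‖ ≤ ((j + m).choose m : ℝ) := by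
  have hj : (0 : ℝ) < (j.factorial : ℝ) := by positivity
  have hasc : ((j + m).choose m : ℝ) * j.factorial = ∏ i ∈ Finset.range j, ((m : ℝ) + 1 + i) := by
    have h := Nat.ascFactorial_eq_factorial_mul_choose m j
    rw [Nat.ascFactorial_eq_prod_range, ← Nat.choose_symm_add, add_comm m j] at h
    have h' := congrArg (Nat.cast : ℕ → ℝ) h
    push_cast at h'
    rw [h', mul_comm]
  rw [binomC, norm_div, Complex.norm_natCast, div_le_iff₀ hj, hasc, norm_prod]
  refine Finset.prod_le_prod (fun _ _ => norm_nonneg _) fun i _ => ?_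
  calc ‖z + (i : ℂ)‖ ≤ ‖z‖ + ‖(i : ℂ)‖ := norm_add_le _ _
    _ ≤ m + 1 + i := by rw [Complex.norm_natCast]; gcongr

theorem hasSum_binomC_mul_pow (z : ℂ) {x : ℝ} (hx0 : 0 ≤ x) (hx1 : x < 1) :
    HasSum (fun j : ℕ => binomC z j * (x : ℂ) ^ j) (rcpow (1 - x) (-z)) := by
  have hball : (x : ℂ) ∈ Metric.eball (0 : ℂ) 1 := by
    rw [← ENNReal.ofReal_one, Metric.eball_ofReal]
    simpa [abs_of_nonneg hx0] using hx1
  have h := (Complex.one_div_one_sub_cpow_hasFPowerSeriesOnBall_zero z).hasSum hball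
  have hne : (1 : ℂ) - x ≠ 0 := by
    rw [← Complex.ofReal_one, ← Complex.ofReal_sub, Complex.ofReal_ne_zero]
    linarith
  have hval : 1 / (1 - (0 + (x : ℂ))) ^ z = rcpow (1 - x) (-z) := by
    rw [zero_add, one_div, ← Complex.cpow_neg, Complex.cpow_def_of_ne_zero hne, rcpow,
      Complex.ofReal_log (by linarith), mul_comm]
    simp
  rw [hval] at h
  have hterm : (fun j : ℕ => binomC z j * (x : ℂ) ^ j) = fun j : ℕ =>
      FormalMultilinearSeries.ofScalars ℂ (fun n : ℕ => Ring.choose (z + n - 1) n) j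
        fun _ => (x : ℂ) := by
    ext j
    simp [FormalMultilinearSeries.ofScalars, binomC_eq_choose]
  rw [hterm]
  exact h

theorem rcpow_add (a : ℝ) (v w : ℂ) : rcpow a (v + w) = rcpow a v * rcpow a w := by
  rw [rcpow, add_mul, Complex.exp_add, rcpow, rcpow]

theorem rcpow_ofReal {a : ℝ} (ha : 0 < a) (x : ℝ) : rcpow a (x : ℂ) = ((a ^ x : ℝ) : ℂ) := by
  rw [rcpow, Real.rpow_def_of_pos ha, mul_comm]
  push_cast
  rfl

theorem norm_rcpow {a : ℝ} (ha : 0 < a) (w : ℂ) : ‖rcpow a w‖ = a ^ w.re := by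
  rw [rcpow, Complex.norm_exp, Real.rpow_def_of_pos ha, Complex.re_mul_ofReal, mul_comm]

theorem differentiable_rcpow (a : ℝ) : Differentiable ℂ (rcpow a) := by
  unfold rcpow
  fun_prop

theorem rcpow_eq_one_iff {q : ℝ} (hq0 : 0 < q) (hq1 : q < 1) (c : ℝ) (z : ℂ) :
    rcpow q (c + z) = 1 ↔
      ∃ k : ℤ, z = ((-c : ℝ) : ℂ) +
        2 * (Real.pi : ℂ) * Complex.I * (k : ℂ) / (Real.log q : ℂ) := by
  have hlog : (Real.log q : ℂ) ≠ 0 :=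
    Complex.ofReal_ne_zero.mpr (Real.log_neg hq0 hq1).ne
  rw [rcpow, Complex.exp_eq_one_iff]
  refine exists_congr fun k => ?_
  rw [← eq_div_iff hlog, add_comm, ← eq_sub_iff_add_eq]
  push_cast
  rw [show (k : ℂ) * (2 * Real.pi * Complex.I) / Real.log q - c =
    -c + 2 * Real.pi * Complex.I * k / Real.log q by ring]

theorem mem_poleSet_compl_iff {q : ℝ} (hq0 : 0 < q) (hq1 : q < 1) (β δ : ℝ) (z : ℂ) :
    z ∈ (poleSet q β δ)ᶜ ↔ ∀ j : ℕ,
      rcpow q (((β - δ + 2 * (j : ℝ)) : ℝ) + z) ≠ 1 ∧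
      rcpow q (((β + δ + 2 * (j : ℝ)) : ℝ) + z) ≠ 1 := by
  simp only [poleSet, Set.mem_compl_iff, Set.mem_ofPred_eq, ne_eq, rcpow_eq_one_iff hq0 hq1,
    ← not_or, ← not_exists, exists_or]
  have h₁ : ∀ j : ℕ, -(β - δ + 2 * (j : ℝ)) = -β + δ - 2 * j := fun j => by ring
  have h₂ : ∀ j : ℕ, -(β + δ + 2 * (j : ℝ)) = -β - δ - 2 * j := fun j => by ring
  simp only [h₁, h₂]

theorem eventually_norm_rcpow_le_half {q : ℝ} (hq0 : 0 < q) (hq1 : q < 1) (c : ℝ) (z₀ : ℂ) :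
    ∀ᶠ j : ℕ in atTop, ∀ z ∈ Metric.ball z₀ 1,
      ‖rcpow q (((c + 2 * (j : ℝ)) : ℝ) + z)‖ ≤ 1 / 2 := by
  have hq2 : q ^ 2 < 1 := by nlinarith
  have hlim : Tendsto (fun j : ℕ => q ^ (c + z₀.re - 1) * (q ^ 2) ^ j) atTop (𝓝 0) := by
    simpa using (tendsto_pow_atTop_nhds_zero_of_lt_one (by positivity) hq2).const_mul
      (q ^ (c + z₀.re - 1))
  filter_upwards [hlim.eventually_le_const (show (0 : ℝ) < 1 / 2 by norm_num)] with j hj z hz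
  refine le_trans ?_ hj
  have hre : z₀.re - 1 ≤ z.re := by
    have h := (Complex.abs_re_le_norm (z - z₀)).trans_lt (mem_ball_iff_norm.mp hz)
    rw [Complex.sub_re] at h
    linarith [(abs_lt.mp h).1]
  rw [norm_rcpow hq0, ← pow_mul, ← Real.rpow_natCast, ← Real.rpow_add hq0]
  refine Real.rpow_le_rpow_of_exponent_ge hq0 hq1.le ?_
  simp only [Complex.add_re, Complex.ofReal_re, Nat.cast_mul, Nat.cast_ofNat]
  linarith

theorem isOpen_poleSet_compl {q : ℝ} (hq0 : 0 < q) (hq1 : q < 1) (β δ : ℝ) :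
    IsOpen (poleSet q β δ)ᶜ := by
  rw [isOpen_iff_mem_nhds]
  intro z₀ hz₀
  obtain ⟨N, hN⟩ := eventually_atTop.mp
    ((eventually_norm_rcpow_le_half hq0 hq1 (β - δ) z₀).and
      (eventually_norm_rcpow_le_half hq0 hq1 (β + δ) z₀))
  have hne : ∀ {w : ℂ}, ‖w‖ ≤ 1 / 2 → w ≠ 1 := by
    rintro w hw rfl
    norm_num at hw
  have hcont : ∀ c : ℂ, ContinuousAt (fun z => rcpow q (c + z)) z₀ := fun c =>
    (differentiable_rcpow q).continuous.continuousAt.comp (by fun_prop)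
  have hz₀' := (mem_poleSet_compl_iff hq0 hq1 β δ z₀).mp hz₀
  have hfin : ∀ᶠ z in 𝓝 z₀, ∀ j ∈ Finset.range N,
      rcpow q (((β - δ + 2 * (j : ℝ)) : ℝ) + z) ≠ 1 ∧
      rcpow q (((β + δ + 2 * (j : ℝ)) : ℝ) + z) ≠ 1 :=
    (Filter.eventually_all_finset _).mpr fun j _ =>
      ((hcont _).eventually_ne (hz₀' j).1).and ((hcont _).eventually_ne (hz₀' j).2)
  filter_upwards [hfin, Metric.ball_mem_nhds z₀ one_pos] with z hz hball
  refine (mem_poleSet_compl_iff hq0 hq1 β δ z).mpr fun j => ?_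
  rcases lt_or_ge j N with hj | hj
  · exact hz j (Finset.mem_range.mpr hj)
  · exact ⟨hne ((hN j hj).1 z hball), hne ((hN j hj).2 z hball)⟩

theorem summable_choose_mul_pow {q : ℝ} (hq0 : 0 < q) (hq1 : q < 1) (m : ℕ) :
    Summable fun j : ℕ => ((j + m).choose m : ℝ) * q ^ (2 * j) := by
  have hq2 : ‖q ^ 2‖ < 1 := by
    rw [Real.norm_of_nonneg (by positivity)]
    nlinarith
  simpa only [pow_mul] using summable_choose_mul_geometric_of_norm_lt_one m hq2

theorem tendstoLocallyUniformlyOn_Fterm {q : ℝ} (hq0 : 0 < q) (hq1 : q < 1) (β δ : ℝ)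
    (s : Set ℂ) :
    TendstoLocallyUniformlyOn
      (fun (N : ℕ) (z : ℂ) => ∑ j ∈ Finset.range N, Fterm q β δ z j)
      (fun z : ℂ => ∑' j : ℕ, Fterm q β δ z j) atTop s := by
  refine tendstoLocallyUniformlyOn_of_forall_exists_nhds fun z₀ _ =>
    ⟨Metric.ball z₀ 1, mem_nhdsWithin_of_mem_nhds (Metric.ball_mem_nhds z₀ one_pos), ?_⟩
  obtain ⟨m, hm⟩ := exists_nat_ge ‖z₀‖
  have hhalf : ∀ {w : ℂ}, ‖w‖ ≤ 1 / 2 → 1 / 2 ≤ ‖1 - w‖ := fun {w} hw => by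
    have h := norm_sub_norm_le (1 : ℂ) w
    rw [norm_one] at h
    linarith
  refine tendstoUniformlyOn_tsum_nat_eventually
    ((summable_choose_mul_pow hq0 hq1 m).mul_right 4) ?_
  filter_upwards [eventually_norm_rcpow_le_half hq0 hq1 (β - δ) z₀,
    eventually_norm_rcpow_le_half hq0 hq1 (β + δ) z₀] with j h₁ h₂ z hz
  have hzm : ‖z‖ ≤ m + 1 := by
    have h := norm_sub_norm_le z z₀
    linarith [mem_ball_iff_norm.mp hz]
  have hden : 1 / 2 * (1 / 2) ≤ ‖1 - rcpow q (((β - δ + 2 * (j : ℝ)) : ℝ) + z)‖ *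
      ‖1 - rcpow q (((β + δ + 2 * (j : ℝ)) : ℝ) + z)‖ :=
    mul_le_mul (hhalf (h₁ z hz)) (hhalf (h₂ z hz)) (by norm_num) (norm_nonneg _)
  rw [Fterm, norm_div, norm_mul, norm_mul, norm_pow, Complex.norm_real,
    Real.norm_of_nonneg hq0.le, div_le_iff₀ (by linarith)]
  have hb := mul_le_mul_of_nonneg_right (norm_binomC_le hzm j)
    (pow_nonneg hq0.le (2 * j))
  have hnn : (0 : ℝ) ≤ ((j + m).choose m : ℝ) * q ^ (2 * j) := by positivity
  nlinarith

theorem differentiableAt_Fterm {q : ℝ} (hq0 : 0 < q) (hq1 : q < 1) {β δ : ℝ} {z : ℂ}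
    (hz : z ∈ (poleSet q β δ)ᶜ) (j : ℕ) :
    DifferentiableAt ℂ (fun w => Fterm q β δ w j) z := by
  have hr : ∀ c : ℂ, DifferentiableAt ℂ (fun w => rcpow q (c + w)) z := fun c =>
    (differentiable_rcpow q _).comp z (by fun_prop)
  have hne := (mem_poleSet_compl_iff hq0 hq1 β δ z).mp hz j
  unfold Fterm binomC
  refine DifferentiableAt.div (by fun_prop)
    (((hr _).const_sub 1).mul ((hr _).const_sub 1)) ?_
  exact mul_ne_zero (sub_ne_zero.mpr hne.1.symm) (sub_ne_zero.mpr hne.2.symm)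

theorem differentiableOn_Ffun {q : ℝ} (hq0 : 0 < q) (hq1 : q < 1) (β δ : ℝ) :
    DifferentiableOn ℂ (Ffun q β δ) (poleSet q β δ)ᶜ := by
  have hsum : DifferentiableOn ℂ (fun z : ℂ => ∑' j : ℕ, Fterm q β δ z j) (poleSet q β δ)ᶜ :=
    (tendstoLocallyUniformlyOn_Fterm hq0 hq1 β δ _).differentiableOn
      (Eventually.of_forall fun N z hz => (DifferentiableAt.fun_sum fun j _ =>
        differentiableAt_Fterm hq0 hq1 hz j).differentiableWithinAt)
      (isOpen_poleSet_compl hq0 hq1 β δ)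
  exact ((differentiable_rcpow _).differentiableOn.const_mul _).mul hsum

/-- A geometric sum of `2n + 2` terms, with the terms paired up two by two. -/
theorem pow_mul_sum_range_pow_eq_sum_antidiagonal {R : Type*} [CommRing R] {y y' : R}
    (h : y * y' = 1) (n : ℕ) :
    y' ^ n * ∑ j ∈ Finset.range (2 * n + 2), y ^ j =
      (1 + y) * ∑ p ∈ Finset.HasAntidiagonal.antidiagonal n, y ^ p.1 * y' ^ p.2 := by
  have hpair : ∑ j ∈ Finset.range (2 * n + 2), y ^ j =
      (1 + y) * ∑ i ∈ Finset.range (n + 1), y ^ (2 * i) := by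
    induction n with
    | zero => simp [Finset.sum_range_succ]
    | succ k ih =>
      rw [show 2 * (k + 1) + 2 = 2 * k + 2 + 1 + 1 by ring, Finset.sum_range_succ,
        Finset.sum_range_succ, ih, Finset.sum_range_succ _ (k + 1)]
      ring
  rw [hpair, mul_left_comm, Finset.mul_sum,
    Finset.Nat.sum_antidiagonal_eq_sum_range_succ (fun i k => y ^ i * y' ^ k)]
  congr 1
  refine Finset.sum_congr rfl fun i hi => ?_
  obtain ⟨k, rfl⟩ := Nat.exists_eq_add_of_le (Nat.lt_succ_iff.mp (Finset.mem_range.mp hi))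
  rw [Nat.add_sub_cancel_left, pow_add, two_mul, pow_add]
  have hi1 : y ^ i * y' ^ i = 1 := by rw [← mul_pow, h, one_pow]
  linear_combination (y ^ i * y' ^ k) * hi1

theorem tsum_sum_antidiagonal_pow {a b : ℂ} (ha : ‖a‖ < 1) (hb : ‖b‖ < 1) :
    ∑' n : ℕ, ∑ p ∈ Finset.HasAntidiagonal.antidiagonal n, a ^ p.1 * b ^ p.2 =
      1 / ((1 - b) * (1 - a)) := by
  rw [← tsum_mul_tsum_eq_tsum_sum_antidiagonal_of_summable_norm
    (summable_norm_geometric_of_norm_lt_one ha) (summable_norm_geometric_of_norm_lt_one hb),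
    tsum_geometric_of_norm_lt_one ha, tsum_geometric_of_norm_lt_one hb, one_div, mul_inv, mul_comm]

theorem qnum_natCast_add_one {q : ℝ} (hq0 : 0 < q) (hq1 : q < 1) (n : ℕ) :
    qnum q ((n : ℝ) + 1) = (1 - (q ^ 2) ^ (n + 1)) / ((1 - q ^ 2) * q ^ n) := by
  have h1 : 1 - q ^ 2 ≠ 0 := by nlinarith
  have h2 : q - q⁻¹ ≠ 0 := by
    have := one_lt_inv₀ hq0 |>.mpr hq1
    linarith
  have hcast : (n : ℝ) + 1 = ((n + 1 : ℕ) : ℝ) := by push_cast; rfl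
  rw [qnum, Real.rpow_neg hq0.le, hcast, Real.rpow_natCast, div_eq_div_iff h2 (by positivity)]
  field_simp
  ring

theorem rcpow_qnum {q : ℝ} (hq0 : 0 < q) (hq1 : q < 1) (z : ℂ) (n : ℕ) :
    rcpow (qnum q ((n : ℝ) + 1)) (-z) =
      rcpow (1 - q ^ 2) z * (rcpow q z ^ n * rcpow (1 - (q ^ 2) ^ (n + 1)) (-z)) := by
  have h1 : 1 - q ^ 2 ≠ 0 := by nlinarith
  have h2 : 1 - (q ^ 2) ^ (n + 1) ≠ 0 :=
    (sub_pos.mpr (pow_lt_one₀ (by positivity) (by nlinarith) n.succ_ne_zero)).ne'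
  rw [qnum_natCast_add_one hq0 hq1, rcpow, rcpow, rcpow, rcpow, ← Complex.exp_nat_mul,
    ← Complex.exp_add, ← Complex.exp_add, Real.log_div h2 (by positivity),
    Real.log_mul h1 (by positivity), Real.log_pow]
  push_cast
  ring_nf

theorem sum_qzetaTerm {q : ℝ} (hq0 : 0 < q) (hq1 : q < 1) (β δ : ℝ) (z : ℂ) (n : ℕ) :
    ∑ j ∈ Finset.range (2 * n + 2), qzetaTerm q β δ z n j =
      ((q ^ (β / 2) * (q ^ (-δ / 2) + q ^ (δ / 2)) : ℝ) : ℂ) * rcpow (1 - q ^ 2) z *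
        ((∑ p ∈ Finset.HasAntidiagonal.antidiagonal n,
          rcpow q (((β + δ : ℝ) : ℂ) + z) ^ p.1 * rcpow q (((β - δ : ℝ) : ℂ) + z) ^ p.2) *
            rcpow (1 - (q ^ 2) ^ (n + 1)) (-z)) := by
  have hyy : q ^ δ * q ^ (-δ) = 1 := by rw [← Real.rpow_add hq0, add_neg_cancel, Real.rpow_zero]
  have hhalf : q ^ (-δ / 2) * (1 + q ^ δ) = q ^ (-δ / 2) + q ^ (δ / 2) := by
    rw [mul_add, mul_one, ← Real.rpow_add hq0]
    ring_nf
  have hreal : ∑ j ∈ Finset.range (2 * n + 2),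
      q ^ (β * ((n : ℝ) + 1/2) + δ * ((j : ℝ) - (n : ℝ) - 1/2)) =
      q ^ (β / 2) * (q ^ (-δ / 2) + q ^ (δ / 2)) * ((q ^ β) ^ n *
        ∑ p ∈ Finset.HasAntidiagonal.antidiagonal n, (q ^ δ) ^ p.1 * (q ^ (-δ)) ^ p.2) := by
    have hterm : ∀ j : ℕ, q ^ (β * ((n : ℝ) + 1/2) + δ * ((j : ℝ) - (n : ℝ) - 1/2)) =
        q ^ (β / 2) * q ^ (-δ / 2) * (q ^ β) ^ n * (q ^ (-δ)) ^ n * (q ^ δ) ^ j := fun j => by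
      simp only [← Real.rpow_mul_natCast hq0.le, ← Real.rpow_add hq0]
      ring_nf
    rw [Finset.sum_congr rfl fun j _ => hterm j, ← Finset.mul_sum, mul_assoc _ ((q ^ (-δ)) ^ n),
      pow_mul_sum_range_pow_eq_sum_antidiagonal hyy, ← hhalf]
    ring
  have hanti : (rcpow q z) ^ n * (((q ^ β) ^ n *
        ∑ p ∈ Finset.HasAntidiagonal.antidiagonal n, (q ^ δ) ^ p.1 * (q ^ (-δ)) ^ p.2 : ℝ) : ℂ) =
      ∑ p ∈ Finset.HasAntidiagonal.antidiagonal n,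
        rcpow q (((β + δ : ℝ) : ℂ) + z) ^ p.1 * rcpow q (((β - δ : ℝ) : ℂ) + z) ^ p.2 := by
    rw [sub_eq_add_neg, rcpow_add, rcpow_add, rcpow_ofReal hq0, rcpow_ofReal hq0,
      Real.rpow_add hq0, Real.rpow_add hq0]
    push_cast
    rw [Finset.mul_sum, Finset.mul_sum]
    refine Finset.sum_congr rfl fun p hp => ?_
    rw [← Finset.HasAntidiagonal.mem_antidiagonal.mp hp]
    ring
  simp only [qzetaTerm]
  rw [← Finset.sum_mul, ← Complex.ofReal_sum, hreal, rcpow_qnum hq0 hq1, ← hanti]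
  push_cast
  ring

theorem Ffun_eq_qzeta {q : ℝ} (hq0 : 0 < q) (hq1 : q < 1) {β δ : ℝ} {z : ℂ}
    (hz : -β + |δ| < z.re) : Ffun q β δ z = qzeta q β δ z := by
  have hq2 : q ^ 2 < 1 := by nlinarith
  set a : ℂ := rcpow q (((β + δ : ℝ) : ℂ) + z) with ha_def
  set b : ℂ := rcpow q (((β - δ : ℝ) : ℂ) + z) with hb_def
  set H : ℕ → ℂ := fun n => ∑ p ∈ Finset.HasAntidiagonal.antidiagonal n, a ^ p.1 * b ^ p.2
    with hH_def
  have ha : ‖a‖ < 1 := by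
    rw [ha_def, norm_rcpow hq0, Complex.add_re, Complex.ofReal_re]
    exact Real.rpow_lt_one hq0.le hq1 (by linarith [neg_abs_le δ])
  have hb : ‖b‖ < 1 := by
    rw [hb_def, norm_rcpow hq0, Complex.add_re, Complex.ofReal_re]
    exact Real.rpow_lt_one hq0.le hq1 (by linarith [le_abs_self δ])
  have hshift : ∀ (c : ℝ) (j : ℕ),
      rcpow q (((c + 2 * (j : ℝ)) : ℝ) + z) = rcpow q ((c : ℂ) + z) * ((q : ℂ) ^ 2) ^ j :=
    fun c j => by
      rw [Complex.ofReal_add, add_right_comm, rcpow_add, rcpow_ofReal hq0,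
        show (2 : ℝ) * j = ((2 * j : ℕ) : ℝ) by push_cast; rfl, Real.rpow_natCast, pow_mul]
      push_cast
      rfl
  set G : ℕ → ℕ → ℂ := fun j n => binomC z j * ((q : ℂ) ^ 2) ^ j * ((((q : ℂ) ^ 2) ^ j) ^ n * H n)
    with hG_def
  have hqn : ‖(q : ℂ) ^ 2‖ = q ^ 2 := by
    rw [norm_pow, Complex.norm_real, Real.norm_of_nonneg hq0.le]
  have hqj : ∀ j : ℕ, ‖((q : ℂ) ^ 2) ^ j‖ ≤ 1 := fun j => by
    rw [norm_pow, hqn]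
    exact pow_le_one₀ (by positivity) hq2.le
  have hrow : ∀ j, ∑' n, G j n = Fterm q β δ z j := fun j => by
    have hlt : ∀ {w : ℂ}, ‖w‖ < 1 → ‖w * ((q : ℂ) ^ 2) ^ j‖ < 1 := fun {w} hw => by
      rw [norm_mul]
      exact (mul_le_of_le_one_right (norm_nonneg _) (hqj j)).trans_lt hw
    have hHj : ∀ n, (((q : ℂ) ^ 2) ^ j) ^ n * H n =
        ∑ p ∈ Finset.HasAntidiagonal.antidiagonal n,
          (a * ((q : ℂ) ^ 2) ^ j) ^ p.1 * (b * ((q : ℂ) ^ 2) ^ j) ^ p.2 := fun n => by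
      rw [hH_def, Finset.mul_sum]
      refine Finset.sum_congr rfl fun p hp => ?_
      rw [← Finset.HasAntidiagonal.mem_antidiagonal.mp hp, mul_pow, mul_pow, pow_add]
      ring
    rw [hG_def, tsum_mul_left, tsum_congr hHj, tsum_sum_antidiagonal_pow (hlt ha) (hlt hb), Fterm,
      hshift, hshift, pow_mul, mul_one_div]
  have hcol : ∀ n, ∑' j, G j n = H n * rcpow (1 - (q ^ 2) ^ (n + 1)) (-z) := fun n => by
    have h := hasSum_binomC_mul_pow z (x := (q ^ 2) ^ (n + 1)) (by positivity)
      (pow_lt_one₀ (by positivity) hq2 n.succ_ne_zero)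
    rw [← h.tsum_eq, ← tsum_mul_left]
    refine tsum_congr fun j => ?_
    rw [hG_def]
    push_cast
    ring
  have hsummable : Summable (Function.uncurry G) := by
    obtain ⟨m, hm⟩ := exists_nat_ge ‖z‖
    have hHs : Summable fun n => ‖H n‖ := summable_norm_sum_mul_antidiagonal_of_summable_norm
      (summable_norm_geometric_of_norm_lt_one ha) (summable_norm_geometric_of_norm_lt_one hb)
    refine Summable.of_norm_bounded ((summable_choose_mul_pow hq0 hq1 m).mul_of_nonneg hHs
      (fun j => by positivity) fun n => norm_nonneg _) ?_
    rintro ⟨j, n⟩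
    simp only [Function.uncurry_apply_pair, hG_def]
    rw [norm_mul, norm_mul, norm_mul, norm_pow _ j, hqn, ← pow_mul]
    gcongr
    · exact norm_binomC_le (by linarith) j
    · rw [norm_pow]
      exact mul_le_of_le_one_left (norm_nonneg _) (pow_le_one₀ (norm_nonneg _) (hqj j))
  rw [Ffun, qzeta, tsum_congr fun n => sum_qzetaTerm hq0 hq1 β δ z n, tsum_mul_left]
  congr 1
  calc ∑' j, Fterm q β δ z j = ∑' j, ∑' n, G j n := tsum_congr fun j => (hrow j).symm
    _ = ∑' n, ∑' j, G j n := hsummable.tsum_comm.symm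
    _ = _ := tsum_congr hcol

theorem statement3 (q : ℝ) (hq0 : 0 < q) (hq1 : q < 1) (β δ : ℝ) :
    TendstoLocallyUniformlyOn
      (fun (N : ℕ) (z : ℂ) => ∑ j ∈ Finset.range N, Fterm q β δ z j)
      (fun z : ℂ => ∑' j : ℕ, Fterm q β δ z j) atTop (poleSet q β δ)ᶜ ∧
    DifferentiableOn ℂ (Ffun q β δ) (poleSet q β δ)ᶜ ∧
    ∀ z : ℂ, -β + |δ| < z.re → Ffun q β δ z = qzeta q β δ z := by
  exact ⟨tendstoLocallyUniformlyOn_Fterm hq0 hq1 β δ _, differentiableOn_Ffun hq0 hq1 β δ,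
    fun _ hz => Ffun_eq_qzeta hq0 hq1 hz⟩
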